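/- arXiv:2112.12664 — 3 statements merged into one kernel-verified Lean document; each statement's English description precedes it below -/
import Mathlib

section
/- Let n ∈ ℕ, let h and ℓ be real polynomials in n variables, let f : ℝⁿ → ℝⁿ be a continuous vector field, and let ε > 0. Define the set I := {x ∈ ℝⁿ : h(x) ≤ 0} and write ∇h(x) for the gradient of h at x. Suppose that for all x ∈ ℝⁿ, ℓ(x)·h(x) + ∇h(x)·f(x) + ε ≤ 0. Then I is invariant for ẋ = f(x): for every T ∈ (0, ∞], every curve x : [0,T) → ℝⁿ that is differentiable on [0,T) with derivative x'(t) = f(x(t)) for all t ∈ [0,T), and which satisfies h(x(0)) ≤ 0, satisfies h(x(t)) ≤ 0 for all t ∈ [0,T). -/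
open Matrix MvPolynomial
open scoped ENNReal

/-- The gradient of a multivariate polynomial, as a vector of evaluated partial derivatives. -/
noncomputable def gradPoly {n : ℕ} (h : MvPolynomial (Fin n) ℝ) (x : Fin n → ℝ) : Fin n → ℝ :=
  fun i => eval x (pderiv i h)

theorem chain_aux {n : ℕ} (p : MvPolynomial (Fin n) ℝ) (x : ℝ → (Fin n → ℝ)) (v : Fin n → ℝ)
    (S : Set ℝ) (t : ℝ) (hx : HasDerivWithinAt x v S t) :
    HasDerivWithinAt (fun s => eval (x s) p) (gradPoly p (x t) ⬝ᵥ v) S t := by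
  induction p using MvPolynomial.induction_on with
  | C a => simpa [gradPoly, dotProduct] using hasDerivWithinAt_const t S a
  | add p q hp hq =>
    have h1 := hp.add hq
    have e : gradPoly (p + q) (x t) = gradPoly p (x t) + gradPoly q (x t) := by
      ext i; simp [gradPoly]
    rw [e, add_dotProduct]
    have e2 : (fun s => eval (x s) (p + q)) =
        (fun s => eval (x s) p) + fun s => eval (x s) q := by
      funext s; simp
    rw [e2]
    exact h1
  | mul_X p i hp =>
    have h1 := hp.mul (hasDerivWithinAt_pi.1 hx i)
    have e : gradPoly (p * X i) (x t) =
        (x t i) • gradPoly p (x t) + (eval (x t) p) • Pi.single i 1 := by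
      ext j
      by_cases hj : j = i
      · subst hj; simp [gradPoly, pderiv_X]; ring
      · simp [gradPoly, pderiv_X, hj, Pi.single_apply, Ne.symm hj]
    rw [e, add_dotProduct, smul_dotProduct, smul_dotProduct, single_dotProduct]
    have e2 : (fun s => eval (x s) (p * X i)) =
        (fun s => eval (x s) p) * fun s => x s i := by
      funext s; simp
    have e3 : x t i • (gradPoly p (x t) ⬝ᵥ v) + (eval (x t)) p • (1 * v i) =
        gradPoly p (x t) ⬝ᵥ v * x t i + (eval (x t)) p * v i := by
      simp only [smul_eq_mul]; ring
    rw [e2, e3]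
    exact h1

/-- If `ℓ(x)h(x) + ∇h(x)·f(x) + ε ≤ 0` for all `x`, then `{h ≤ 0}` is invariant for
`ẋ = f(x)`: every solution defined on `[0, T)` (with `T ∈ (0, ∞]`) starting in the set
remains in the set. -/
theorem invariance_of_certificate (n : ℕ) (h ℓ : MvPolynomial (Fin n) ℝ)
    (f : (Fin n → ℝ) → (Fin n → ℝ)) (hf : Continuous f) (ε : ℝ) (hε : 0 < ε)
    (hcert : ∀ x : Fin n → ℝ, eval x ℓ * eval x h + gradPoly h x ⬝ᵥ f x + ε ≤ 0)
    (T : ℝ≥0∞) (hT : 0 < T) (x : ℝ → (Fin n → ℝ))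
    (hx : ∀ t ∈ {s : ℝ | 0 ≤ s ∧ ENNReal.ofReal s < T},
      HasDerivWithinAt x (f (x t)) {s : ℝ | 0 ≤ s ∧ ENNReal.ofReal s < T} t)
    (hx0 : eval (x 0) h ≤ 0) :
    ∀ t ∈ {s : ℝ | 0 ≤ s ∧ ENNReal.ofReal s < T}, eval (x t) h ≤ 0 := by
  rintro b ⟨hb0, hbT⟩
  have hsub : Set.Icc 0 b ⊆ {s : ℝ | 0 ≤ s ∧ ENNReal.ofReal s < T} := fun s hs =>
    ⟨hs.1, (ENNReal.ofReal_le_ofReal hs.2).trans_lt hbT⟩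
  have hd : ∀ t ∈ Set.Icc 0 b, HasDerivWithinAt (fun s => eval (x s) h)
      (gradPoly h (x t) ⬝ᵥ f (x t)) (Set.Icc 0 b) t := fun t ht =>
    chain_aux h x _ _ t ((hx t (hsub ht)).mono hsub)
  refine image_le_of_deriv_right_lt_deriv_boundary' (f := fun s => eval (x s) h)
    (f' := fun t => gradPoly h (x t) ⬝ᵥ f (x t)) (B := fun _ => 0) (B' := fun _ => 0)
    (a := 0) (b := b) (fun t ht => (hd t ht).continuousWithinAt) ?_ hx0 continuousOn_const
    (fun t _ => hasDerivWithinAt_const _ _ _) ?_ ⟨hb0, le_rfl⟩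
  · intro t ht
    refine ((hd t ⟨ht.1, ht.2.le⟩).mono (Set.Icc_subset_Icc_left ht.1)).mono_of_mem_nhdsWithin ?_
    exact Icc_mem_nhdsGE ht.2
  · intro t _ h0
    have := hcert (x t)
    rw [h0] at this
    linarith
end

section
/- Let p, n ∈ ℕ, ζ₀ ∈ ℝ^{p×n}, let P ∈ ℝ^{p×p} be symmetric positive definite, and let Q ∈ ℝ^{n×n} be symmetric positive definite with positive definite square root Q^{1/2}. Then the following two sets of matrices are equal: {ζ ∈ ℝ^{p×n} : (ζ − ζ₀)ᵀP⁻²(ζ − ζ₀) ⪯ Q} = {ζ₀ + PYQ^{1/2} : Y ∈ ℝ^{p×n}, YᵀY ⪯ I}. -/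
open Matrix

/-- The matrix ellipsoid `{ζ : (ζ − ζ₀)ᵀ P⁻² (ζ − ζ₀) ⪯ Q}` equals the parametrized set
`{ζ₀ + P Y Q^{1/2} : YᵀY ⪯ I}`. -/
theorem matrix_ellipsoid_param (p n : ℕ) (ζ₀ : Matrix (Fin p) (Fin n) ℝ)
    (P : Matrix (Fin p) (Fin p) ℝ) (hP : P.PosDef)
    (Q : Matrix (Fin n) (Fin n) ℝ) (hQ : Q.PosDef)
    (Qhalf : Matrix (Fin n) (Fin n) ℝ) (hQhalf : Qhalf.PosDef)
    (hQhalfsq : Qhalf * Qhalf = Q) :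
    {ζ : Matrix (Fin p) (Fin n) ℝ |
        (Q - (ζ - ζ₀)ᵀ * (P * P)⁻¹ * (ζ - ζ₀)).PosSemidef} =
      {ζ : Matrix (Fin p) (Fin n) ℝ | ∃ Y : Matrix (Fin p) (Fin n) ℝ,
        ((1 : Matrix (Fin n) (Fin n) ℝ) - Yᵀ * Y).PosSemidef ∧ ζ = ζ₀ + P * Y * Qhalf} := by
  have hPT : Pᵀ = P := by simpa using hP.isHermitian.eq
  have hHT : Qhalfᵀ = Qhalf := by simpa using hQhalf.isHermitian.eq
  have hPu : IsUnit P.det := (Matrix.isUnit_iff_isUnit_det _).1 hP.isUnit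
  have hHu : IsUnit Qhalf.det := (Matrix.isUnit_iff_isUnit_det _).1 hQhalf.isUnit
  have key : ∀ Y : Matrix (Fin p) (Fin n) ℝ,
      Q - (P * Y * Qhalf)ᵀ * (P * P)⁻¹ * (P * Y * Qhalf) =
        Qhalf * (1 - Yᵀ * Y) * Qhalf := by
    intro Y
    have h1 : P * ((P * P)⁻¹ * P) = 1 := by
      rw [Matrix.mul_inv_rev, Matrix.mul_assoc, Matrix.nonsing_inv_mul _ hPu, Matrix.mul_one,
        Matrix.mul_nonsing_inv _ hPu]
    have h2 : (P * Y * Qhalf)ᵀ * (P * P)⁻¹ * (P * Y * Qhalf) =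
        Qhalf * Yᵀ * (P * ((P * P)⁻¹ * P)) * (Y * Qhalf) := by
      simp only [Matrix.transpose_mul, hPT, hHT, Matrix.mul_assoc]
    rw [h2, h1, ← hQhalfsq]
    simp only [Matrix.mul_sub, Matrix.sub_mul, Matrix.mul_one, Matrix.mul_assoc]
  ext ζ
  simp only [Set.mem_setOf_eq]
  constructor
  · intro h
    have hz : P * (P⁻¹ * (ζ - ζ₀) * Qhalf⁻¹) * Qhalf = ζ - ζ₀ := by
      rw [Matrix.mul_assoc, Matrix.mul_assoc _ Qhalf⁻¹, Matrix.nonsing_inv_mul _ hHu,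
        Matrix.mul_one, ← Matrix.mul_assoc, Matrix.mul_nonsing_inv _ hPu, Matrix.one_mul]
    refine ⟨P⁻¹ * (ζ - ζ₀) * Qhalf⁻¹, ?_, by rw [hz]; abel⟩
    have k := key (P⁻¹ * (ζ - ζ₀) * Qhalf⁻¹)
    rw [hz] at k
    rw [k] at h
    generalize (1 - (P⁻¹ * (ζ - ζ₀) * Qhalf⁻¹)ᵀ * (P⁻¹ * (ζ - ζ₀) * Qhalf⁻¹)) = M at h ⊢
    have h3 := h.conjTranspose_mul_mul_same Qhalf⁻¹
    have h4 : Qhalf⁻¹ᴴ = Qhalf⁻¹ := by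
      rw [Matrix.conjTranspose_nonsing_inv, hQhalf.isHermitian.eq]
    have h5 : Qhalf⁻¹ * (Qhalf * M * Qhalf) * Qhalf⁻¹ = M := by
      rw [Matrix.mul_assoc, Matrix.mul_assoc _ Qhalf, Matrix.mul_nonsing_inv _ hHu,
        Matrix.mul_one, ← Matrix.mul_assoc, Matrix.nonsing_inv_mul _ hHu, Matrix.one_mul]
    rwa [h4, h5] at h3
  · rintro ⟨Y, hY, rfl⟩
    rw [add_sub_cancel_left, key]
    have h3 := hY.conjTranspose_mul_mul_same Qhalf
    rwa [hQhalf.isHermitian.eq] at h3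
end

section
/- Let n, N, T ∈ ℕ, ω ≥ 0, X₁ ∈ ℝⁿˣᵀ, G ∈ ℝᴺˣᵀ, and define A_e := GGᵀ, B_e := −GX₁ᵀ, C_e := −TωI + X₁X₁ᵀ. Then for every ζ ∈ ℝᴺˣⁿ, the matrix identity C_e + ζᵀB_e + B_eᵀζ + ζᵀA_eζ = (X₁ − ζᵀG)(X₁ − ζᵀG)ᵀ − TωI holds; consequently, there exists D ∈ ℝⁿˣᵀ with X₁ = ζᵀG + D and DDᵀ ⪯ TωI if and only if C_e + ζᵀB_e + B_eᵀζ + ζᵀA_eζ ⪯ 0. -/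
open Matrix

/-- Energy-bound consistency characterization: with `A_e := GGᵀ`, `B_e := −GX₁ᵀ`,
`C_e := −TωI + X₁X₁ᵀ`, the identity
`C_e + ζᵀB_e + B_eᵀζ + ζᵀA_eζ = (X₁ − ζᵀG)(X₁ − ζᵀG)ᵀ − TωI` holds, and
`∃ D, X₁ = ζᵀG + D ∧ DDᵀ ⪯ TωI` iff `C_e + ζᵀB_e + B_eᵀζ + ζᵀA_eζ ⪯ 0`. -/
theorem energy_bound_consistency (n N T : ℕ) (ω : ℝ) (hω : 0 ≤ ω)
    (X1 : Matrix (Fin n) (Fin T) ℝ) (G : Matrix (Fin N) (Fin T) ℝ)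
    (Ae : Matrix (Fin N) (Fin N) ℝ) (hAe : Ae = G * Gᵀ)
    (Be : Matrix (Fin N) (Fin n) ℝ) (hBe : Be = -(G * X1ᵀ))
    (Ce : Matrix (Fin n) (Fin n) ℝ)
    (hCe : Ce = -(((T : ℝ) * ω) • (1 : Matrix (Fin n) (Fin n) ℝ)) + X1 * X1ᵀ) :
    ∀ ζ : Matrix (Fin N) (Fin n) ℝ,
      (Ce + ζᵀ * Be + Beᵀ * ζ + ζᵀ * Ae * ζ
          = (X1 - ζᵀ * G) * (X1 - ζᵀ * G)ᵀ - ((T : ℝ) * ω) • (1 : Matrix (Fin n) (Fin n) ℝ)) ∧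
      ((∃ D : Matrix (Fin n) (Fin T) ℝ, X1 = ζᵀ * G + D ∧
          (((T : ℝ) * ω) • (1 : Matrix (Fin n) (Fin n) ℝ) - D * Dᵀ).PosSemidef) ↔
        (-(Ce + ζᵀ * Be + Beᵀ * ζ + ζᵀ * Ae * ζ)).PosSemidef) := by
  intro ζ
  have key : Ce + ζᵀ * Be + Beᵀ * ζ + ζᵀ * Ae * ζ
      = (X1 - ζᵀ * G) * (X1 - ζᵀ * G)ᵀ - ((T : ℝ) * ω) • (1 : Matrix (Fin n) (Fin n) ℝ) := by
    subst hAe hBe hCe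
    simp only [Matrix.transpose_sub, Matrix.transpose_mul, Matrix.transpose_neg,
      Matrix.transpose_transpose, Matrix.mul_sub, Matrix.sub_mul, Matrix.mul_neg,
      Matrix.neg_mul, Matrix.mul_assoc]
    abel
  refine ⟨key, ?_⟩
  rw [key, neg_sub]
  constructor
  · rintro ⟨D, hD, h⟩
    have hD2 : X1 - ζᵀ * G = D := by rw [hD]; abel
    rw [hD2]
    exact h
  · intro h
    exact ⟨X1 - ζᵀ * G, by abel, h⟩
end
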